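/- The non-semilinear language L_expo = { a^{2^0} b a^{2^2} b ⋯ b a^{2^{2m}} c a^{2^{2m+1}} b ⋯ b a^{2^3} b a^{2^1} : m ≥ 1 } is accepted by a reversible deterministic two-party Watson-Crick system that uses at most O(log n) communications in both forward and reverse computations on inputs of length n. -/

import Mathlib

namespace WK

/-- Tape symbols: input symbols plus the two endmarkers.
`Sum.inr false` is the left endmarker, `Sum.inr true` the right endmarker. -/
abbrev TSym (α : Type) : Type := α ⊕ Bool

/-- The tape for input `w`: left endmarker, the symbols of `w`, right endmarker. -/
def tape {α : Type} (w : List α) (k : ℕ) : TSym α :=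
  ((Sum.inr false :: w.map Sum.inl) ++ [Sum.inr true]).getD k (Sum.inr true)

/-- A deterministic two-party Watson-Crick system: two finite automata (the upper
component `1` and the lower component `2`) with a finite set `M` of messages,
partial transition functions `δᵢ` (depending on state, scanned symbol and received
message, `none` = no message) and broadcast functions `μᵢ`. -/
structure DPWK (α : Type) where
  M : Type
  Q1 : Type
  Q2 : Type
  fM : Fintype M
  fQ1 : Fintype Q1
  fQ2 : Fintype Q2
  δ1 : Q1 → TSym α → Option M → Option (Q1 × Bool)
  δ2 : Q2 → TSym α → Option M → Option (Q2 × Bool)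
  μ1 : Q1 → TSym α → Option M
  μ2 : Q2 → TSym α → Option M
  q01 : Q1
  q02 : Q2
  F1 : Set Q1
  F2 : Set Q2

/-- A configuration: states and head positions of the two components. -/
structure Config {α : Type} (A : DPWK α) where
  p : A.Q1
  i : ℕ
  q : A.Q2
  j : ℕ

/-- One synchronous (forward) computation step: each component reads its symbol,
receives the message broadcast by the other component, changes its state and
optionally moves (the upper head to the right, the lower head to the left). -/
def Step {α : Type} (A : DPWK α) (w : List α) (c c' : Config A) : Prop :=
  ∃ d1 d2 : Bool,
    A.δ1 c.p (tape w c.i) (A.μ2 c.q (tape w c.j)) = some (c'.p, d1) ∧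
    A.δ2 c.q (tape w c.j) (A.μ1 c.p (tape w c.i)) = some (c'.q, d2) ∧
    c'.i = c.i + (cond d1 1 0) ∧ c.j = c'.j + (cond d2 1 0)

/-- The initial configuration on input `w`: the upper component on the left
endmarker, the lower component on the right endmarker. -/
def initConf {α : Type} (A : DPWK α) (w : List α) : Config A :=
  ⟨A.q01, 0, A.q02, w.length + 1⟩

/-- The system halts in `c` if no successor configuration exists. -/
def Halted {α : Type} (A : DPWK α) (w : List α) (c : Config A) : Prop :=
  ¬ ∃ c', Step A w c c'

/-- A configuration is accepting if at least one component is in an accepting state. -/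
def AccConf {α : Type} (A : DPWK α) (c : Config A) : Prop :=
  c.p ∈ A.F1 ∨ c.q ∈ A.F2

/-- `cs` is an accepting computation of `A` on `w`: it starts in the initial
configuration, follows the step relation, and ends in a halting configuration
with at least one component in an accepting state. -/
def AccComp {α : Type} (A : DPWK α) (w : List α) (cs : List (Config A)) : Prop :=
  cs.head? = some (initConf A w) ∧ List.Chain' (Step A w) cs ∧
    ∃ c, cs.getLast? = some c ∧ Halted A w c ∧ AccConf A c

def Accepts {α : Type} (A : DPWK α) (w : List α) : Prop := ∃ cs, AccComp A w cs

/-- The language accepted by `A`. -/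
def lang {α : Type} (A : DPWK α) : Set (List α) := { w | Accepts A w }

/-- One backward computation step, induced by reverse transition functions `δ'ᵢ` and
reverse broadcast functions `μ'ᵢ`: the heads first move to their predecessor
positions (the upper head left, the lower head right) and then read the symbols there. -/
def BackStep {α : Type} (A : DPWK α)
    (δ'1 : A.Q1 → TSym α → Option A.M → Option (A.Q1 × Bool))
    (δ'2 : A.Q2 → TSym α → Option A.M → Option (A.Q2 × Bool))
    (μ'1 : A.Q1 → TSym α → Option A.M)
    (μ'2 : A.Q2 → TSym α → Option A.M)
    (w : List α) (c' c : Config A) : Prop :=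
  ∃ d1 d2 : Bool,
    δ'1 c'.p (tape w c.i) (μ'2 c'.q (tape w c.j)) = some (c.p, d1) ∧
    δ'2 c'.q (tape w c.j) (μ'1 c'.p (tape w c.i)) = some (c.q, d2) ∧
    c'.i = c.i + (cond d1 1 0) ∧ c.j = c'.j + (cond d2 1 0)

/-- A witness of reversibility: reverse transition and broadcast functions whose
induced backward step relation is exactly the inverse of the forward step relation,
so every configuration has at most one predecessor, computable by such a system. -/
structure RevWitness {α : Type} (A : DPWK α) where
  δ'1 : A.Q1 → TSym α → Option A.M → Option (A.Q1 × Bool)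
  δ'2 : A.Q2 → TSym α → Option A.M → Option (A.Q2 × Bool)
  μ'1 : A.Q1 → TSym α → Option A.M
  μ'2 : A.Q2 → TSym α → Option A.M
  inverse : ∀ (w : List α) (c c' : Config A),
    BackStep A δ'1 δ'2 μ'1 μ'2 w c' c ↔ Step A w c c'

/-- A reversible deterministic two-party Watson-Crick system (REV-PWK). -/
def Reversible {α : Type} (A : DPWK α) : Prop := Nonempty (RevWitness A)

/-- Number of messages (`0`, `1` or `2`) broadcast in one step from configuration `c`,
with respect to broadcast functions `μ1`, `μ2`. -/
def stepMsgs {α : Type} (A : DPWK α)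
    (μ1 : A.Q1 → TSym α → Option A.M) (μ2 : A.Q2 → TSym α → Option A.M)
    (w : List α) (c : Config A) : ℕ :=
  ((μ1 c.p (tape w c.i)).elim 0 fun _ => 1) + ((μ2 c.q (tape w c.j)).elim 0 fun _ => 1)

/-- Total number of messages sent during the computation `cs` (no messages are
sent from the final, halting configuration). -/
def commCount {α : Type} (A : DPWK α)
    (μ1 : A.Q1 → TSym α → Option A.M) (μ2 : A.Q2 → TSym α → Option A.M)
    (w : List α) (cs : List (Config A)) : ℕ :=
  (cs.dropLast.map (stepMsgs A μ1 μ2 w)).sum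

/-- `A` is a reversible system that is communication bounded by `f`: it is reversible
and every word of its language is accepted by a computation in which the number of
messages sent in the forward computation and in the reverse computation are each at
most `f` of the input length. -/
def RevCommBounded {α : Type} (A : DPWK α) (f : ℕ → ℕ) : Prop :=
  ∃ Wit : RevWitness A, ∀ w ∈ lang A, ∃ cs, AccComp A w cs ∧
    commCount A A.μ1 A.μ2 w cs ≤ f w.length ∧
    commCount A Wit.μ'1 Wit.μ'2 w cs.reverse ≤ f w.length

/-- `A` (not necessarily reversible) is communication bounded by `f`. -/
def CommBounded {α : Type} (A : DPWK α) (f : ℕ → ℕ) : Prop :=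
  ∀ w ∈ lang A, ∃ cs, AccComp A w cs ∧ commCount A A.μ1 A.μ2 w cs ≤ f w.length

/-- The family of languages accepted by reversible deterministic two-party
Watson-Crick systems over the alphabet `α`. -/
def RevPWKLangs (α : Type) : Set (Set (List α)) :=
  { L | ∃ A : DPWK α, Reversible A ∧ lang A = L }

/-- Languages accepted by REV-PWKs with `O(f)` communication. -/
def RevPWKLangsO (α : Type) (f : ℕ → ℕ) : Set (Set (List α)) :=
  { L | ∃ (A : DPWK α) (C : ℕ),
      RevCommBounded A (fun n => C * f n + C) ∧ lang A = L }

/-- Languages accepted by (possibly irreversible) DPWKs with `O(f)` communication. -/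
def PWKLangsO (α : Type) (f : ℕ → ℕ) : Set (Set (List α)) :=
  { L | ∃ (A : DPWK α) (C : ℕ),
      CommBounded A (fun n => C * f n + C) ∧ lang A = L }

end WK

/-- Alphabet `{a, b, c}` as `Fin 3`: `a = 0`, `b = 1`, `c = 2`. -/
notation "Γ₃" => Fin 3

/-- The left part `a^{2^0} b a^{2^2} b ⋯ b a^{2^{2m}}` of a word of `L_expo`. -/
def expoLeft (m : ℕ) : List Γ₃ :=
  (List.intersperse [(1 : Γ₃)]
    ((List.range (m + 1)).map fun i => List.replicate (2 ^ (2 * i)) (0 : Γ₃))).flatten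

/-- The right part `a^{2^{2m+1}} b ⋯ b a^{2^3} b a^{2^1}` of a word of `L_expo`. -/
def expoRight (m : ℕ) : List Γ₃ :=
  (List.intersperse [(1 : Γ₃)]
    (((List.range (m + 1)).reverse).map fun i =>
      List.replicate (2 ^ (2 * i + 1)) (0 : Γ₃))).flatten

/-- `L_expo = { a^{2^0} b a^{2^2} b ⋯ b a^{2^{2m}} c a^{2^{2m+1}} b ⋯ b a^{2^3} b a^{2^1} : m ≥ 1 }`. -/
def Lexpo : Set (List Γ₃) :=
  { w | ∃ m : ℕ, 1 ≤ m ∧ w = expoLeft m ++ [(2 : Γ₃)] ++ expoRight m }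


namespace WK.Expo

open WK

set_option linter.constructorNameAsVariable false

inductive U | p0 | p1 | r0 | s0 | s1 | f0
deriving DecidableEq

instance : Fintype U := ⟨{.p0, .p1, .r0, .s0, .s1, .f0}, by intro x; cases x <;> decide⟩

inductive V | q | t | v | g0 | g1 | g2
deriving DecidableEq

instance : Fintype V := ⟨{.q, .t, .v, .g0, .g1, .g2}, by intro x; cases x <;> decide⟩

abbrev S := TSym (Fin 3)
abbrev a : S := Sum.inl 0
abbrev b : S := Sum.inl 1
abbrev cc : S := Sum.inl 2
abbrev lE : S := Sum.inr false
abbrev rE : S := Sum.inr true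

def sig (x : S) : Option S := if x = a then none else some x

def mu1 (_ : U) (x : S) : Option S := sig x

def mu2 : V → S → Option S
  | .q, y => sig y
  | .v, y => sig y
  | _, _ => none

def nu2 : V → S → Option S
  | .q, y => sig y
  | .v, y => if y = b then some b else none
  | .g0, y => if y = b then some b else none
  | _, _ => none

def d1 : U → S → Option S → Option (U × Bool)
  | .p0, .inr false, some (.inr true) => some (.p0, true)
  | .p0, .inl 0, none => some (.p1, false)
  | .p1, .inl 0, none => some (.p0, true)
  | .p0, .inl 1, some (.inl 1) => some (.p0, true)
  | .p0, .inl 2, some (.inl 2) => some (.r0, true)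
  | .r0, .inl 0, none => some (.r0, true)
  | .r0, .inl 1, none => some (.s0, true)
  | .s0, .inl 0, none => some (.s1, false)
  | .s1, .inl 0, none => some (.s0, true)
  | .s0, .inl 1, some (.inl 1) => some (.s0, true)
  | .s0, .inr true, some (.inl 1) => some (.f0, false)
  | .f0, .inr true, none => some (.f0, false)
  | _, _, _ => none

def d2 : V → S → Option S → Option (V × Bool)
  | .q, .inr true, some (.inr false) => some (.q, true)
  | .q, .inl 0, none => some (.q, true)
  | .q, .inl 1, some (.inl 1) => some (.q, true)
  | .q, .inl 2, some (.inl 2) => some (.t, false)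
  | .t, .inl 2, none => some (.t, false)
  | .t, .inl 2, some (.inl 1) => some (.v, true)
  | .v, .inl 0, none => some (.v, true)
  | .v, .inl 1, some (.inl 1) => some (.v, true)
  | .v, .inl 1, some (.inr true) => some (.g0, true)
  | .g0, .inl 0, some (.inr true) => some (.g1, true)
  | .g1, .inr false, some (.inr true) => some (.g2, false)
  | _, _, _ => none

def e1 : U → S → Option S → Option (U × Bool)
  | .p0, .inr false, some (.inr true) => some (.p0, true)
  | .p1, .inl 0, none => some (.p0, false)
  | .p0, .inl 0, none => some (.p1, true)
  | .p0, .inl 1, some (.inl 1) => some (.p0, true)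
  | .r0, .inl 2, none => some (.p0, true)
  | .r0, .inl 0, none => some (.r0, true)
  | .s0, .inl 1, none => some (.r0, true)
  | .s1, .inl 0, none => some (.s0, false)
  | .s0, .inl 0, none => some (.s1, true)
  | .s0, .inl 1, some (.inl 1) => some (.s0, true)
  | .f0, .inr true, some (.inl 1) => some (.s0, false)
  | .f0, .inr true, none => some (.f0, false)
  | _, _, _ => none

def e2 : V → S → Option S → Option (V × Bool)
  | .q, .inr true, some (.inr false) => some (.q, true)
  | .q, .inl 0, none => some (.q, true)
  | .q, .inl 1, some (.inl 1) => some (.q, true)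
  | .t, .inl 2, some (.inl 2) => some (.q, false)
  | .t, .inl 2, none => some (.t, false)
  | .v, .inl 2, some (.inl 1) => some (.t, true)
  | .v, .inl 0, none => some (.v, true)
  | .v, .inl 1, some (.inl 1) => some (.v, true)
  | .g0, .inl 1, some (.inr true) => some (.v, true)
  | .g1, .inl 0, some (.inr true) => some (.g0, true)
  | .g2, .inr false, some (.inr true) => some (.g1, false)
  | _, _, _ => none

def M : DPWK (Fin 3) where
  M := S
  Q1 := U
  Q2 := V
  fM := inferInstance
  fQ1 := inferInstance
  fQ2 := inferInstance
  δ1 := d1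
  δ2 := d2
  μ1 := mu1
  μ2 := mu2
  q01 := .p0
  q02 := .q
  F1 := ∅
  F2 := {.g2}

theorem fwd : ∀ p x q y, ∀ r ∈ d1 p x (mu2 q y), ∀ s ∈ d2 q y (mu1 p x),
    e1 r.1 x (nu2 s.1 y) = some (p, r.2) ∧ e2 s.1 y (mu1 r.1 x) = some (q, s.2) := by
  decide +kernel

theorem bwd : ∀ p x q y, ∀ r ∈ e1 p x (nu2 q y), ∀ s ∈ e2 q y (mu1 p x),
    d1 r.1 x (mu2 s.1 y) = some (p, r.2) ∧ d2 s.1 y (mu1 r.1 x) = some (q, s.2) := by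
  decide +kernel

def wit : RevWitness M where
  δ'1 := e1
  δ'2 := e2
  μ'1 := mu1
  μ'2 := nu2
  inverse := by
    intro w c c'
    constructor
    · rintro ⟨x, y, h1, h2, h3, h4⟩
      obtain ⟨k1, k2⟩ := bwd _ _ _ _ _ h1 _ h2
      exact ⟨x, y, k1, k2, h3, h4⟩
    · rintro ⟨x, y, h1, h2, h3, h4⟩
      obtain ⟨k1, k2⟩ := fwd _ _ _ _ _ h1 _ h2
      exact ⟨x, y, k1, k2, h3, h4⟩

/-- Combined message cost of a configuration. -/
def cost (w : List (Fin 3)) (c : Config M) : ℕ :=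
  stepMsgs M mu1 mu2 w c + stepMsgs M mu1 nu2 w c

inductive AccK (w : List (Fin 3)) : ℕ → Config M → Prop
  | halt (k : ℕ) (c : Config M) : Halted M w c → AccConf M c → AccK w k c
  | step (k e : ℕ) (c c' : Config M) : Step M w c c' → AccK w k c' → cost w c ≤ e → AccK w (k + e) c

theorem elim_le {T : Type} (o : Option T) : (o.elim 0 fun _ => 1) ≤ 1 := by
  cases o <;> simp

theorem stepMsgs_le (m1 : U → S → Option S) (m2 : V → S → Option S) (w : List (Fin 3))
    (c : Config M) : stepMsgs M m1 m2 w c ≤ 2 := by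
  exact Nat.add_le_add (elim_le _) (elim_le _)

theorem AccK.run {w k c} (h : AccK w k c) : ∃ cs : List (Config M), ∃ hne : cs ≠ [],
    cs.head? = some c ∧ List.IsChain (Step M w) cs ∧ Halted M w (cs.getLast hne) ∧
    AccConf M (cs.getLast hne) ∧ ((cs.dropLast).map (cost w)).sum ≤ k := by
  induction h with
  | halt k c h1 h2 => exact ⟨[c], by simp, by simp, by simp, by simpa, by simpa, by simp⟩
  | step k e c c' hs _ hc ih =>
    obtain ⟨cs, hne, h1, h2, h3, h4, h5⟩ := ih
    obtain ⟨d, cs, rfl⟩ := List.exists_cons_of_ne_nil hne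
    simp only [List.head?_cons, Option.some.injEq] at h1
    subst h1
    refine ⟨c :: d :: cs, by simp, by simp, by simp [hs, h2], by simpa using h3, by simpa using h4, ?_⟩
    simp only [List.dropLast_cons_cons, List.map_cons, List.sum_cons]
    omega

theorem AccK.comp {w k} (h : AccK w k (initConf M w)) : ∃ cs, AccComp M w cs ∧
    commCount M M.μ1 M.μ2 w cs ≤ k + 2 ∧ commCount M wit.μ'1 wit.μ'2 w cs.reverse ≤ k + 2 := by
  obtain ⟨cs, hne, h1, h2, h3, h4, h5⟩ := h.run
  refine ⟨cs, ⟨h1, h2, _, List.getLast?_eq_some_getLast hne, h3, h4⟩, ?_, ?_⟩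
  · refine le_trans ?_ (le_trans h5 (by omega))
    unfold commCount
    apply List.sum_le_sum
    intro c _
    exact Nat.le_add_right _ _
  · unfold commCount
    rw [List.dropLast_reverse, List.map_reverse, List.sum_reverse]
    have h6 : (cs.map (stepMsgs M wit.μ'1 wit.μ'2 w)).sum ≤ k + 2 := by
      rw [← List.dropLast_append_getLast hne]
      simp only [List.map_append, List.sum_append, List.map_cons, List.map_nil, List.sum_cons,
        List.sum_nil]
      have := stepMsgs_le mu1 nu2 w (cs.getLast hne)
      have h7 : (cs.dropLast.map (stepMsgs M wit.μ'1 wit.μ'2 w)).sum ≤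
          (cs.dropLast.map (cost w)).sum := by
        apply List.sum_le_sum
        intro c _
        exact Nat.le_add_left _ _
      change _ + (stepMsgs M mu1 nu2 w (cs.getLast hne) + 0) ≤ _
      omega
    obtain ⟨d, cs, rfl⟩ := List.exists_cons_of_ne_nil hne
    simp at h6 ⊢
    omega

theorem exists_AccK {w} (cs : List (Config M)) : ∀ c, cs.head? = some c →
    List.IsChain (Step M w) cs → ∀ d, cs.getLast? = some d → Halted M w d → AccConf M d →
    ∃ k, AccK w k c := by
  induction cs with
  | nil => simp
  | cons e cs ih =>
    intro c h1 h2 d h3 h4 h5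
    simp only [List.head?_cons, Option.some.injEq] at h1
    subst h1
    cases cs with
    | nil =>
      simp at h3
      subst h3
      exact ⟨0, .halt _ _ h4 h5⟩
    | cons f cs =>
      simp only [List.isChain_cons_cons] at h2
      obtain ⟨k, hk⟩ := ih f (by simp) h2.2 d (by simpa using h3) h4 h5
      exact ⟨_, .step k _ e f h2.1 hk le_rfl⟩

/-! Positional description of accepted words. -/

inductive P2 (t : ℕ → S) : ℕ → ℕ → ℕ → Prop
  | a (i j k) : t i = a → t (j+2) = a → t (j+1) = a → P2 t (i+1) j k → P2 t i (j+2) k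
  | b (i j k) : t i = b → t (j+1) = b → P2 t (i+1) j k → P2 t i (j+1) (k+1)
  | e (i j) : t i = rE → t (j+2) = b → t (j+1) = a → t j = lE → P2 t i (j+2) 0

inductive P15 (t : ℕ → S) : ℕ → ℕ → ℕ → Prop
  | a (i j k) : t i = a → t j = cc → P15 t (i+1) j k → P15 t i j k
  | b (i j k) : t i = b → t (j+1) = cc → P2 t (i+1) j k → P15 t i (j+1) k

inductive P1 (t : ℕ → S) : ℕ → ℕ → ℕ → Prop
  | s (i j k) : t i = lE → t (j+1) = rE → P1 t (i+1) j k → P1 t i (j+1) (k+1)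
  | a (i j k) : t i = a → t (j+2) = a → t (j+1) = a → P1 t (i+1) j k → P1 t i (j+2) k
  | b (i j k) : t i = b → t (j+1) = b → P1 t (i+1) j k → P1 t i (j+1) (k+1)
  | c (i j k) : t i = cc → t j = cc → P15 t (i+1) j k → P1 t i j k

theorem AccK.go {w : List (Fin 3)} {k} {p : U} {i} {q : V} {j} (e : ℕ) (p' : U) (i' : ℕ) (q' : V) (j' : ℕ) (x y : Bool)
    (h : AccK w k ⟨p', i', q', j'⟩)
    (h1 : d1 p (tape w i) (mu2 q (tape w j)) = some (p', x))
    (h2 : d2 q (tape w j) (mu1 p (tape w i)) = some (q', y))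
    (h3 : i' = i + cond x 1 0) (h4 : j = j' + cond y 1 0)
    (h5 : cost w ⟨p, i, q, j⟩ ≤ e) : AccK w (k + e) ⟨p, i, q, j⟩ :=
  .step _ _ _ ⟨p', i', q', j'⟩ ⟨x, y, h1, h2, h3, h4⟩ h h5

theorem cost_le (w c) : cost w c ≤ 4 := by
  have := stepMsgs_le mu1 mu2 w c
  have := stepMsgs_le mu1 nu2 w c
  unfold cost; omega

theorem run2 {w : List (Fin 3)} {i j k} (h : P2 (tape w) i j k) :
    AccK w (4 * k + 12) ⟨U.s0, i, V.v, j⟩ := by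
  induction h with
  | a i j k h1 h2 h3 _ ih =>
    refine AccK.go 0 U.s1 i V.v (j+1) false true (AccK.go 0 U.s0 (i+1) V.v j true true ih
      ?_ ?_ rfl rfl ?_) ?_ ?_ rfl rfl ?_
    all_goals simp [h1, h2, h3, d1, d2, mu1, mu2, nu2, sig, cost, stepMsgs, M]
  | b i j k h1 h2 _ ih =>
    refine AccK.go (k := 4 * k + 12) 4 U.s0 (i+1) V.v j true true ih ?_ ?_ rfl rfl (cost_le _ _)
    all_goals simp [h1, h2, d1, d2, mu1, mu2, sig]
  | e i j h1 h2 h3 h4 =>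
    refine AccK.go (k := 8) 4 U.f0 i V.g0 (j+1) false true (AccK.go (k := 4) 4 U.f0 i V.g1 j false true
      (AccK.go (k := 0) 4 U.f0 i V.g2 j false false (.halt _ _ ?_ ?_)
      ?_ ?_ rfl rfl (cost_le _ _)) ?_ ?_ rfl rfl (cost_le _ _)) ?_ ?_ rfl rfl (cost_le _ _)
    · rintro ⟨c', x, y, _, h, _⟩
      simp [M, d2] at h
    · right; rfl
    all_goals simp [h1, h2, h3, h4, d1, d2, mu1, mu2, sig]

theorem run15 {w : List (Fin 3)} {i j k} (h : P15 (tape w) i j k) :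
    AccK w (4 * k + 16) ⟨U.r0, i, V.t, j⟩ := by
  induction h with
  | a i j k h1 h2 _ ih =>
    refine AccK.go 0 U.r0 (i+1) V.t j true false ih ?_ ?_ rfl rfl ?_
    all_goals simp [h1, h2, d1, d2, mu1, mu2, nu2, sig, cost, stepMsgs, M]
  | b i j k h1 h2 h =>
    refine AccK.go (k := 4 * k + 12) 4 U.s0 (i+1) V.v j true true (run2 h) ?_ ?_ rfl rfl (cost_le _ _)
    all_goals simp [h1, h2, d1, d2, mu1, mu2, sig]

theorem run1 {w : List (Fin 3)} {i j k} (h : P1 (tape w) i j k) :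
    AccK w (4 * k + 20) ⟨U.p0, i, V.q, j⟩ := by
  induction h with
  | s i j k h1 h2 _ ih =>
    refine AccK.go (k := 4 * k + 20) 4 U.p0 (i+1) V.q j true true ih ?_ ?_ rfl rfl (cost_le _ _)
    all_goals simp [h1, h2, d1, d2, mu1, mu2, sig]
  | a i j k h1 h2 h3 _ ih =>
    refine AccK.go 0 U.p1 i V.q (j+1) false true (AccK.go 0 U.p0 (i+1) V.q j true true ih
      ?_ ?_ rfl rfl ?_) ?_ ?_ rfl rfl ?_
    all_goals simp [h1, h2, h3, d1, d2, mu1, mu2, nu2, sig, cost, stepMsgs, M]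
  | b i j k h1 h2 _ ih =>
    refine AccK.go (k := 4 * k + 20) 4 U.p0 (i+1) V.q j true true ih ?_ ?_ rfl rfl (cost_le _ _)
    all_goals simp [h1, h2, d1, d2, mu1, mu2, sig]
  | c i j k h1 h2 h =>
    refine AccK.go (k := 4 * k + 16) 4 U.r0 (i+1) V.t j true false (run15 h) ?_ ?_ rfl rfl (cost_le _ _)
    all_goals simp [h1, h2, d1, d2, mu1, mu2, sig]

def Mot (t : ℕ → S) (p : U) (i : ℕ) (q : V) (j : ℕ) : Prop :=
  match p, q with
  | .p0, .q => ∃ k, P1 t i j k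
  | .p1, .q => ∃ j' k, j = j' + 1 ∧ t i = a ∧ t j = a ∧ P1 t (i+1) j' k
  | .r0, .t => ∃ k, P15 t i j k
  | .s0, .v => ∃ k, P2 t i j k
  | .s1, .v => ∃ j' k, j = j' + 1 ∧ t i = a ∧ t j = a ∧ P2 t (i+1) j' k
  | .f0, .g0 => ∃ j', j = j' + 1 ∧ t j = a ∧ t j' = lE
  | .f0, .g1 => t j = lE
  | _, _ => True

theorem S_cases : ∀ s : S, s = a ∨ s = b ∨ s = cc ∨ s = lE ∨ s = rE := by decide

theorem Mot.step (t : ℕ → S) (p : U) (i : ℕ) (q : V) (j : ℕ) (p' : U) (i' : ℕ) (q' : V) (j' : ℕ) (x y : Bool)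
    (h1 : d1 p (t i) (mu2 q (t j)) = some (p', x))
    (h2 : d2 q (t j) (mu1 p (t i)) = some (q', y))
    (h3 : i' = i + cond x 1 0) (h4 : j = j' + cond y 1 0)
    (h : Mot t p' i' q' j') : Mot t p i q j := by
  cases p <;> cases q <;> try trivial
  all_goals
    rcases S_cases (t i) with hx | hx | hx | hx | hx <;>
    rcases S_cases (t j) with hy | hy | hy | hy | hy <;>
    simp [hx, hy, d1, d2, mu1, mu2, sig] at h1 h2
  all_goals
    obtain ⟨rfl, rfl⟩ := h1
    obtain ⟨rfl, rfl⟩ := h2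
    simp only [cond_true, cond_false, add_zero] at h3 h4
    subst h3
    subst h4
    simp only [Mot] at h ⊢
  · obtain ⟨j', k, rfl, h5, h6, h7⟩ := h
    exact ⟨k, .a _ _ _ hx hy h6 h7⟩
  · obtain ⟨k, h⟩ := h
    exact ⟨_, .b _ _ _ hx hy h⟩
  · obtain ⟨k, h⟩ := h
    exact ⟨_, .c _ _ _ hx hy h⟩
  · obtain ⟨k, h⟩ := h
    exact ⟨_, .s _ _ _ hx hy h⟩
  · obtain ⟨k, h⟩ := h
    exact ⟨_, _, rfl, hx, hy, h⟩
  · obtain ⟨k, h⟩ := h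
    exact ⟨_, .a _ _ _ hx hy h⟩
  · obtain ⟨k, h⟩ := h
    exact ⟨_, .b _ _ _ hx hy h⟩
  · obtain ⟨j', k, rfl, h5, h6, h7⟩ := h
    exact ⟨k, .a _ _ _ hx hy h6 h7⟩
  · obtain ⟨k, h⟩ := h
    exact ⟨_, .b _ _ _ hx hy h⟩
  · obtain ⟨j', rfl, h5, h6⟩ := h
    exact ⟨_, .e _ _ hx hy h5 h6⟩
  · obtain ⟨k, h⟩ := h
    exact ⟨_, _, rfl, hx, hy, h⟩
  · exact ⟨_, rfl, hy, h⟩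
  · exact hy

theorem AccK.mot {w k c} (h : AccK w k c) : Mot (tape w) c.p c.i c.q c.j := by
  induction h with
  | halt k c _ h =>
    obtain ⟨p, i, q, j⟩ := c
    rcases h with h | h
    · exact h.elim
    · change q = V.g2 at h
      subst h
      change Mot (tape w) p i V.g2 j
      change U at p
      cases p <;> trivial
  | step k e c c' h _ _ ih =>
    obtain ⟨x, y, h1, h2, h3, h4⟩ := h
    exact Mot.step _ _ _ _ _ _ _ _ _ _ _ h1 h2 h3 h4 ih

/-! Passage to lists. -/

theorem tape_zero (w : List (Fin 3)) : tape w 0 = lE := rfl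

theorem tape_succ (w : List (Fin 3)) (k : ℕ) : tape w (k+1) = (w[k]?).elim rE Sum.inl := by
  unfold tape
  rw [List.cons_append, List.getD_cons_succ, List.getD_eq_getElem?_getD, List.getElem?_append]
  by_cases h : k < w.length
  · simp [h]
  · simp only [List.length_map, h, if_false]
    rw [List.getElem?_eq_none (by omega : w.length ≤ k)]
    cases k - w.length <;> simp

theorem tape_inl {w : List (Fin 3)} {k x} :
    tape w (k+1) = Sum.inl x ↔ w.drop k = x :: w.drop (k+1) := by
  rw [tape_succ]
  by_cases h : k < w.length
  · rw [List.drop_eq_getElem_cons h, List.getElem?_eq_getElem h]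
    simp only [Option.elim_some, Sum.inl.injEq, List.cons.injEq, and_true]
  · rw [List.drop_eq_nil_of_le (by omega), List.getElem?_eq_none (by omega)]; simp

theorem tape_rE {w : List (Fin 3)} {k} : tape w (k+1) = rE ↔ w.drop k = [] := by
  rw [tape_succ]
  by_cases h : k < w.length
  · simp [h]
  · rw [List.drop_eq_nil_of_le (by omega), List.getElem?_eq_none (by omega)]; simp

theorem tape_lE {w : List (Fin 3)} {k} : tape w (k+1) ≠ lE := by
  rw [tape_succ]
  cases w[k]? <;> simp

theorem tape_take {w : List (Fin 3)} {k x} (h : tape w (k+1) = Sum.inl x) :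
    (w.take (k+1)).reverse = x :: (w.take k).reverse := by
  rw [tape_succ] at h
  by_cases h' : k < w.length
  · rw [List.getElem?_eq_getElem h'] at h
    simp only [Option.elim_some, Sum.inl.injEq] at h
    rw [List.take_add_one, List.getElem?_eq_getElem h', h]
    simp only [Option.toList_some, List.reverse_append, List.reverse_cons, List.reverse_nil,
      List.nil_append, List.cons_append]
  · rw [List.getElem?_eq_none (by omega)] at h; simp at h

theorem take_tape {w : List (Fin 3)} {j x Z} (hj : j ≤ w.length)
    (h : (w.take j).reverse = x :: Z) :
    ∃ j', j = j' + 1 ∧ tape w (j'+1) = Sum.inl x ∧ (w.take j').reverse = Z := by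
  cases j with
  | zero => simp at h
  | succ j =>
    have h1 : tape w (j+1) = Sum.inl w[j] := by
      rw [tape_succ, List.getElem?_eq_getElem]; rfl
    have h2 := tape_take h1
    rw [h] at h2
    simp only [List.cons.injEq] at h2
    exact ⟨j, rfl, by rw [h1, h2.1], h2.2.symm⟩

theorem drop_tape {w : List (Fin 3)} {k x Z} (h : w.drop k = x :: Z) :
    tape w (k+1) = Sum.inl x ∧ w.drop (k+1) = Z := by
  have h2 : w.drop (k+1) = Z := by rw [← List.drop_drop, h]; rfl
  exact ⟨tape_inl.2 (by rw [h, h2]), h2⟩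

def ee (L : List ℕ) : List (Fin 3) := L.flatMap fun m => 1 :: List.replicate m 0

def enc (n : ℕ) (L : List ℕ) : List (Fin 3) := List.replicate n 0 ++ ee L

abbrev dbl (L : List ℕ) : List ℕ := L.map (2 * ·)

@[simp] theorem enc_succ (n L) : enc (n+1) L = 0 :: enc n L := by
  simp [enc, List.replicate_succ]

@[simp] theorem enc_cons (n L) : enc 0 (n :: L) = 1 :: enc n L := by
  simp [enc, ee]

@[simp] theorem enc_nil : enc 0 [] = [] := by simp [enc, ee]

theorem ee_cons (n L) : ee (n :: L) = 1 :: enc n L := by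
  simp [enc, ee]

theorem P2.toList {w : List (Fin 3)} {i j k} (h : P2 (tape w) i j k) : ∀ i', i = i' + 1 →
    ∃ n L, w.drop i' = enc n L ∧ (w.take j).reverse = enc (2*n) (dbl L ++ [1]) ∧ k = L.length := by
  induction h with
  | a i j k h1 h2 h3 _ ih =>
    rintro i' rfl
    obtain ⟨n, L, h4, h5, h6⟩ := ih _ rfl
    refine ⟨n+1, L, ?_, ?_, h6⟩
    · rw [tape_inl.1 h1, h4, enc_succ]
    · rw [tape_take h2, tape_take h3, h5, Nat.mul_succ, enc_succ, enc_succ]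
  | b i j k h1 h2 _ ih =>
    rintro i' rfl
    obtain ⟨n, L, h4, h5, h6⟩ := ih _ rfl
    refine ⟨0, n :: L, ?_, ?_, by simp [h6]⟩
    · rw [tape_inl.1 h1, h4, enc_cons]
    · rw [tape_take h2, h5]; simp
  | e i j h1 h2 h3 h4 =>
    rintro i' rfl
    refine ⟨0, [], ?_, ?_, rfl⟩
    · rw [tape_rE.1 h1]; simp
    · rw [tape_take h2, tape_take h3]
      cases j with
      | zero => simp
      | succ j => exact (tape_lE h4).elim

theorem P2.ofList {w : List (Fin 3)} (L : List ℕ) : ∀ n i j, j ≤ w.length → w.drop i = enc n L →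
    (w.take j).reverse = enc (2*n) (dbl L ++ [1]) → P2 (tape w) (i+1) j L.length := by
  induction L with
  | nil =>
    intro n
    induction n with
    | zero =>
      intro i j hj h1 h2
      simp only [List.map_nil, List.nil_append, mul_zero, enc_cons, enc_succ, enc_nil] at h2
      obtain ⟨j, rfl, h3, h4⟩ := take_tape hj h2
      obtain ⟨j, rfl, h5, h6⟩ := take_tape (by omega) h4
      refine .e _ _ (tape_rE.2 (by simpa using h1)) h3 h5 ?_
      have : j = 0 := by
        by_contra h
        have := congrArg List.length h6
        rw [List.length_reverse, List.length_take, List.length_nil] at this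
        omega
      subst this
      rfl
    | succ n ih =>
      intro i j hj h1 h2
      rw [enc_succ] at h1
      rw [Nat.mul_succ, enc_succ, enc_succ] at h2
      obtain ⟨j, rfl, h3, h4⟩ := take_tape hj h2
      obtain ⟨j, rfl, h5, h6⟩ := take_tape (by omega) h4
      obtain ⟨h7, h8⟩ := drop_tape h1
      exact .a _ _ _ h7 h3 h5 (ih _ _ (by omega) h8 h6)
  | cons m L ihL =>
    intro n
    induction n with
    | zero =>
      intro i j hj h1 h2
      rw [enc_cons] at h1
      simp only [List.map_cons, List.cons_append, mul_zero, enc_cons] at h2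
      obtain ⟨j, rfl, h3, h4⟩ := take_tape hj h2
      obtain ⟨h7, h8⟩ := drop_tape h1
      exact .b _ _ _ h7 h3 (ihL _ _ _ (by omega) h8 h4)
    | succ n ih =>
      intro i j hj h1 h2
      rw [enc_succ] at h1
      rw [Nat.mul_succ, enc_succ, enc_succ] at h2
      obtain ⟨j, rfl, h3, h4⟩ := take_tape hj h2
      obtain ⟨j, rfl, h5, h6⟩ := take_tape (by omega) h4
      obtain ⟨h7, h8⟩ := drop_tape h1
      exact .a _ _ _ h7 h3 h5 (ih _ _ (by omega) h8 h6)

theorem P15.toList {w : List (Fin 3)} {i j k} (h : P15 (tape w) i j k) : ∀ i', i = i' + 1 →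
    ∃ l n L, w.drop i' = enc l (n :: L) ∧
      (w.take j).reverse = 2 :: enc (2*n) (dbl L ++ [1]) ∧ k = L.length := by
  induction h with
  | a i j k h1 h2 _ ih =>
    rintro i' rfl
    obtain ⟨l, n, L, h4, h5, h6⟩ := ih _ rfl
    refine ⟨l+1, n, L, ?_, h5, h6⟩
    rw [tape_inl.1 h1, h4, enc_succ]
  | b i j k h1 h2 h =>
    rintro i' rfl
    obtain ⟨n, L, h4, h5, h6⟩ := h.toList _ rfl
    refine ⟨0, n, L, ?_, ?_, h6⟩
    · rw [tape_inl.1 h1, h4, enc_cons]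
    · rw [tape_take h2, h5]

theorem P15.ofList {w : List (Fin 3)} (n L) : ∀ l i j, j ≤ w.length → w.drop i = enc l (n :: L) →
    (w.take j).reverse = 2 :: enc (2*n) (dbl L ++ [1]) → P15 (tape w) (i+1) j L.length := by
  intro l
  induction l with
  | zero =>
    intro i j hj h1 h2
    rw [enc_cons] at h1
    obtain ⟨j, rfl, h3, h4⟩ := take_tape hj h2
    obtain ⟨h7, h8⟩ := drop_tape h1
    exact .b _ _ _ h7 h3 (P2.ofList _ _ _ _ (by omega) h8 h4)
  | succ l ih =>
    intro i j hj h1 h2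
    rw [enc_succ] at h1
    obtain ⟨h7, h8⟩ := drop_tape h1
    obtain ⟨j', rfl, h3, h4⟩ := take_tape hj h2
    exact .a _ _ _ h7 h3 (ih _ _ hj h8 h2)

theorem P1.toList {w : List (Fin 3)} {i j k} (h : P1 (tape w) i j k) : ∀ i', i = i' + 1 →
    ∃ x X l n L, w.drop i' = enc x X ++ 2 :: enc l (n :: L) ∧
      (w.take j).reverse = enc (2*x) (dbl X) ++ 2 :: enc (2*n) (dbl L ++ [1]) := by
  induction h with
  | s i j k h1 =>
    rintro i' rfl
    exact (tape_lE h1).elim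
  | a i j k h1 h2 h3 _ ih =>
    rintro i' rfl
    obtain ⟨x, X, l, n, L, h4, h5⟩ := ih _ rfl
    refine ⟨x+1, X, l, n, L, ?_, ?_⟩
    · rw [tape_inl.1 h1, h4, enc_succ]; rfl
    · rw [tape_take h2, tape_take h3, h5, Nat.mul_succ, enc_succ, enc_succ]; rfl
  | b i j k h1 h2 _ ih =>
    rintro i' rfl
    obtain ⟨x, X, l, n, L, h4, h5⟩ := ih _ rfl
    refine ⟨0, x :: X, l, n, L, ?_, ?_⟩
    · rw [tape_inl.1 h1, h4, enc_cons]; rfl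
    · rw [tape_take h2, h5]; simp
  | c i j k h1 h2 h =>
    rintro i' rfl
    obtain ⟨l, n, L, h4, h5, h6⟩ := h.toList _ rfl
    refine ⟨0, [], l, n, L, ?_, ?_⟩
    · rw [tape_inl.1 h1, h4]; simp
    · rw [h5]; simp

theorem P1.ofList {w : List (Fin 3)} (l n L) (X : List ℕ) : ∀ x i j, j ≤ w.length →
    w.drop i = enc x X ++ 2 :: enc l (n :: L) →
    (w.take j).reverse = enc (2*x) (dbl X) ++ 2 :: enc (2*n) (dbl L ++ [1]) →
    P1 (tape w) (i+1) j (L.length + X.length) := by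
  induction X with
  | nil =>
    intro x
    induction x with
    | zero =>
      intro i j hj h1 h2
      simp only [List.map_nil, mul_zero, enc_nil, List.nil_append] at h1 h2
      obtain ⟨j', rfl, h3, h4⟩ := take_tape hj h2
      obtain ⟨h7, h8⟩ := drop_tape h1
      exact .c _ _ _ h7 h3 (P15.ofList _ _ _ _ _ hj h8 h2)
    | succ x ih =>
      intro i j hj h1 h2
      rw [enc_succ] at h1
      rw [Nat.mul_succ, enc_succ, enc_succ] at h2
      obtain ⟨j, rfl, h3, h4⟩ := take_tape hj h2
      obtain ⟨j, rfl, h5, h6⟩ := take_tape (by omega) h4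
      obtain ⟨h7, h8⟩ := drop_tape h1
      exact .a _ _ _ h7 h3 h5 (ih _ _ (by omega) h8 h6)
  | cons m X ihX =>
    intro x
    induction x with
    | zero =>
      intro i j hj h1 h2
      rw [enc_cons] at h1
      simp only [List.map_cons, mul_zero, enc_cons] at h2
      obtain ⟨j, rfl, h3, h4⟩ := take_tape hj h2
      obtain ⟨h7, h8⟩ := drop_tape h1
      exact .b _ _ _ h7 h3 (ihX _ _ _ (by omega) h8 h4)
    | succ x ih =>
      intro i j hj h1 h2
      rw [enc_succ] at h1
      rw [Nat.mul_succ, enc_succ, enc_succ] at h2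
      obtain ⟨j, rfl, h3, h4⟩ := take_tape hj h2
      obtain ⟨j, rfl, h5, h6⟩ := take_tape (by omega) h4
      obtain ⟨h7, h8⟩ := drop_tape h1
      exact .a _ _ _ h7 h3 h5 (ih _ _ (by omega) h8 h6)

theorem sound {w : List (Fin 3)} (h : w ∈ lang M) : ∃ x X l n L,
    w = enc x X ++ 2 :: enc l (n :: L) ∧
      w.reverse = enc (2*x) (dbl X) ++ 2 :: enc (2*n) (dbl L ++ [1]) := by
  obtain ⟨cs, h1, h2, c, h3, h4, h5⟩ := h
  obtain ⟨k, hk⟩ := exists_AccK cs _ h1 h2 c h3 h4 h5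
  obtain ⟨k, h⟩ : ∃ k, P1 (tape w) 0 (w.length + 1) k := hk.mot
  generalize hi : 0 = i at h
  generalize hj : w.length + 1 = j at h
  cases h with
  | s i j k h1 h2 h =>
    subst hi
    obtain rfl : w.length = j := by omega
    obtain ⟨x, X, l, n, L, h1, h2⟩ := h.toList 0 rfl
    exact ⟨x, X, l, n, L, by simpa using h1, by simpa using h2⟩
  | a i j k h => subst hi; rw [tape_zero] at h; exact absurd h (by decide)
  | b i j k h => subst hi; rw [tape_zero] at h; exact absurd h (by decide)
  | c i j k h => subst hi; rw [tape_zero] at h; exact absurd h (by decide)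

theorem complete {w : List (Fin 3)} {x X l n L} (h1 : w = enc x X ++ 2 :: enc l (n :: L))
    (h2 : w.reverse = enc (2*x) (dbl X) ++ 2 :: enc (2*n) (dbl L ++ [1])) :
    AccK w (4 * (L.length + X.length + 1) + 20) (initConf M w) := by
  refine run1 (.s _ _ _ rfl ?_ (P1.ofList l n L X x 0 _ le_rfl (by simpa using h1) (by simpa using h2)))
  rw [tape_rE]; simp

/-! Combinatorics of the block lengths. -/

theorem two_notMem (n L) : (2 : Fin 3) ∉ enc n L := by
  simp [enc, ee, List.mem_replicate]

theorem enc_inj (L : List ℕ) : ∀ n n' L', enc n L = enc n' L' → n = n' ∧ L = L' := by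
  induction L with
  | nil =>
    intro n
    induction n with
    | zero =>
      intro n' L' h
      cases n' with
      | succ n' => simp at h
      | zero => cases L' <;> simp at h ⊢
    | succ n ih =>
      intro n' L' h
      cases n' with
      | succ n' => simp at h; simpa using ih _ _ h
      | zero => cases L' <;> simp at h
  | cons m L ihL =>
    intro n
    induction n with
    | zero =>
      intro n' L' h
      cases n' with
      | succ n' => simp at h
      | zero =>
        cases L' with
        | nil => simp at h
        | cons m' L' => simp at h; simpa using ihL _ _ _ h
    | succ n ih =>
      intro n' L' h
      cases n' with
      | succ n' => simp at h; simpa using ih _ _ h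
      | zero => cases L' <;> simp at h

theorem ee_append (L L') : ee (L ++ L') = ee L ++ ee L' := by simp [ee]

theorem ee_reverse (L : List ℕ) : (ee L ++ [1]).reverse = ee L.reverse ++ [1] := by
  induction L with
  | nil => rfl
  | cons n L ih =>
    have h1 : ee (n :: L) ++ [1] = 1 :: (List.replicate n 0 ++ (ee L ++ [1])) := by
      simp [ee_cons, enc]
    rw [h1, List.reverse_cons, List.reverse_append, ih, List.reverse_cons, ee_append, ee_cons]
    simp [enc, ee]

theorem enc_reverse {n L n' L'} : (enc n L).reverse = enc n' L' ↔ (n :: L).reverse = n' :: L' := by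
  have h : (1 :: ((enc n L).reverse ++ [1]) = 1 :: (enc n' L' ++ [1])) ↔
      (n :: L).reverse = n' :: L' := by
    have h1 : 1 :: ((enc n L).reverse ++ [1]) = ee (n :: L).reverse ++ [1] := by
      rw [← ee_reverse, ee_cons]; simp
    rw [h1, ← List.cons_append, ← ee_cons, List.append_left_inj]
    constructor
    · intro h
      obtain ⟨m, M, hM⟩ := List.exists_cons_of_ne_nil (show (n :: L).reverse ≠ [] by simp)
      rw [hM, ee_cons, ee_cons] at h
      rw [hM]
      simpa using enc_inj _ _ _ _ (List.cons.inj h).2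
    · intro h; rw [h]
  rw [← h]; simp

theorem split_two : ∀ {A B C D : List (Fin 3)}, A ++ 2 :: B = C ++ 2 :: D → 2 ∉ A → 2 ∉ C →
    A = C ∧ B = D
  | [], B, [], D, h, _, _ => by simpa using h
  | [], B, c :: C, D, h, _, h2 => by
    simp only [List.nil_append, List.cons_append, List.cons.injEq] at h
    simp [h.1] at h2
  | c :: A, B, [], D, h, h1, _ => by
    simp only [List.nil_append, List.cons_append, List.cons.injEq] at h
    simp [h.1] at h1
  | c :: A, B, d :: C, D, h, h1, h2 => by
    simp only [List.cons_append, List.cons.injEq] at h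
    simp only [List.mem_cons, not_or] at h1 h2
    obtain ⟨h3, h4⟩ := split_two h.2 h1.2 h2.2
    exact ⟨by rw [h.1, h3], h4⟩

theorem geom (T : List ℕ) : ∀ l c, T ++ [l] = dbl (c :: dbl T) →
    c :: dbl T = (List.range (T.length + 1)).map (fun i => c * 4 ^ i) ∧
      T ++ [l] = (List.range (T.length + 1)).map (fun i => 2 * (c * 4 ^ i)) := by
  induction T with
  | nil => intro l c h; simp at h; simp [h]
  | cons t T ih =>
    intro l c h
    simp only [List.cons_append, List.map_cons, List.cons.injEq] at h
    obtain ⟨rfl, h⟩ := h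
    obtain ⟨h1, h2⟩ := ih l (2 * (2 * c)) (by simpa using h)
    have h3 : ∀ i, c * 4 ^ (i+1) = 2 * (2 * c) * 4 ^ i := fun i => by ring
    rw [List.length_cons, List.range_succ_eq_map]
    simp only [List.map_cons, List.map_map, List.cons_append]
    rw [h2]
    refine ⟨?_, ?_⟩
    · rw [h1]; simp [Function.comp_def, h3]
    · simp [Function.comp_def, h3]

theorem enc_eq (L : List ℕ) : ∀ n, (List.intersperse [(1 : Fin 3)]
    ((n :: L).map fun k => List.replicate k (0 : Fin 3))).flatten = enc n L := by
  induction L with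
  | nil => intro n; simp [enc, ee]
  | cons m L ih =>
    intro n
    have := ih m
    simp only [List.map_cons] at this ⊢
    rw [List.intersperse_cons_cons, List.flatten_cons, List.flatten_cons, this]
    simp [enc, ee]

theorem left_eq {m x X} (h : x :: X = (List.range (m+1)).map fun i => 1 * 4 ^ i) :
    expoLeft m = enc x X := by
  rw [← enc_eq, h, expoLeft, List.map_map]
  congr 3
  funext i
  simp [pow_mul]

theorem right_eq {m x X} (h : x :: X = ((List.range (m+1)).map fun i => 2 * (1 * 4 ^ i)).reverse) :
    expoRight m = enc x X := by
  rw [← enc_eq, h, expoRight, ← List.map_reverse, List.map_map]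
  congr 3
  funext i
  have : 2 * (1 * 4 ^ i) = 2 ^ (2 * i + 1) := by rw [pow_succ, pow_mul]; ring
  simp only [Function.comp_def, this]

theorem shape {w : List (Fin 3)} {x X l n L} (h1 : w = enc x X ++ 2 :: enc l (n :: L))
    (h2 : w.reverse = enc (2*x) (dbl X) ++ 2 :: enc (2*n) (dbl L ++ [1])) :
    ∃ m, 1 ≤ m ∧ w = expoLeft m ++ [(2 : Fin 3)] ++ expoRight m ∧ X.length = m ∧ L.length + 1 = m ∧
      2 ^ (2 * m) ≤ w.length := by
  have h3 : (enc l (n :: L)).reverse ++ 2 :: (enc x X).reverse =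
      enc (2*x) (dbl X) ++ 2 :: enc (2*n) (dbl L ++ [1]) := by
    rw [← h2, h1]; simp
  obtain ⟨h4, h5⟩ := split_two h3 (by simpa using two_notMem _ _) (two_notMem _ _)
  rw [enc_reverse] at h4 h5
  have h6 : x :: X = 1 :: dbl (n :: L).reverse := by
    have := congrArg List.reverse h5
    rw [List.reverse_reverse] at this
    rw [this]; simp
  have h7 : (n :: L).reverse ++ [l] = dbl (1 :: dbl (n :: L).reverse) := by
    rw [← h6, ← List.reverse_cons, h4]; rfl
  obtain ⟨h8, h9⟩ := geom _ _ _ h7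
  rw [List.length_reverse, List.length_cons] at h8 h9
  have hl : l = 2 * (1 * 4 ^ (L.length + 1)) := by
    rw [List.range_succ, List.map_append] at h9
    exact List.cons.inj (List.append_inj' h9 rfl).2 |>.1
  refine ⟨L.length + 1, by omega, ?_, ?_, rfl, ?_⟩
  · rw [left_eq (h6.trans h8), right_eq (x := l) (X := n :: L) (by rw [← h9]; simp), h1]; simp
  · have := congrArg List.length h6
    simpa using this
  · rw [h1, pow_mul]
    simp [enc]
    norm_num at hl ⊢
    omega

theorem ofLexpo {w : List (Fin 3)} (h : w ∈ Lexpo) : ∃ x X l n L,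
    w = enc x X ++ 2 :: enc l (n :: L) ∧
      w.reverse = enc (2*x) (dbl X) ++ 2 :: enc (2*n) (dbl L ++ [1]) := by
  obtain ⟨m, hm, rfl⟩ := h
  obtain ⟨m, rfl⟩ : ∃ m', m = m' + 1 := ⟨m - 1, by omega⟩
  have hY : 1 :: (List.range (m+1)).map (fun i => 4 * 4 ^ i) =
      (List.range (m+1+1)).map fun i => 1 * 4 ^ i := by
    rw [List.range_succ_eq_map (n := m+1)]
    simp [Function.comp_def, pow_succ, mul_comm]
  have hR : 2 * (1 * 4 ^ (m+1)) :: 2 * (1 * 4 ^ m) :: ((List.range m).map fun i => 2 * (1 * 4 ^ i)).reverse =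
      ((List.range (m+1+1)).map fun i => 2 * (1 * 4 ^ i)).reverse := by
    rw [List.range_succ (n := m+1), List.range_succ (n := m)]
    simp
  refine ⟨_, _, _, _, _, by rw [left_eq hY, right_eq hR, List.append_assoc]; rfl, ?_⟩
  rw [left_eq hY, right_eq hR]
  have h1 := (enc_reverse (n := 2 * (1 * 4 ^ (m+1)))
    (L := 2 * (1 * 4 ^ m) :: ((List.range m).map fun i => 2 * (1 * 4 ^ i)).reverse)
    (n' := 2 * 1) (L' := dbl ((List.range (m+1)).map (fun i => 4 * 4 ^ i)))).2 (by
      rw [hR, List.reverse_reverse, ← List.map_cons (f := (2 * ·)), hY, List.map_map]; rfl)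
  have h2 := (enc_reverse (n := 1) (L := (List.range (m+1)).map (fun i => 4 * 4 ^ i))
    (n' := 2 * (2 * (1 * 4 ^ m)))
    (L' := dbl ((List.range m).map fun i => 2 * (1 * 4 ^ i)).reverse ++ [1])).2 (by
      rw [List.range_succ]
      simp [← mul_assoc])
  rw [List.reverse_append, List.reverse_append, h1, h2]; rfl

end WK.Expo

open WK in
/-- The (non-semilinear) language `L_expo` is accepted by a
reversible deterministic two-party Watson-Crick system using `O(log n)` messages
in both forward and reverse computations on inputs of length `n`. -/
theorem Lexpo_in_REV_PWK_log :
    ∃ (A : DPWK Γ₃) (C : ℕ),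
      RevCommBounded A (fun n => C * Nat.log 2 n + C) ∧ lang A = Lexpo := by
  refine ⟨Expo.M, 22, ⟨Expo.wit, ?_⟩, ?_⟩
  · intro w hw
    obtain ⟨x, X, l, n, L, h1, h2⟩ := Expo.sound hw
    obtain ⟨m, hm, h3, h4, h5, h6⟩ := Expo.shape h1 h2
    obtain ⟨cs, hcs, h7, h8⟩ := (Expo.complete h1 h2).comp
    have h9 : 2 * m ≤ Nat.log 2 w.length :=
      Nat.le_log_of_pow_le (by norm_num) h6
    have h10 : 4 * (L.length + X.length + 1) + 20 + 2 ≤ 22 * Nat.log 2 w.length + 22 := by omega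
    exact ⟨cs, hcs, h7.trans h10, h8.trans h10⟩
  · ext w
    constructor
    · intro hw
      obtain ⟨x, X, l, n, L, h1, h2⟩ := Expo.sound hw
      obtain ⟨m, hm, h3, h4, h5, h6⟩ := Expo.shape h1 h2
      exact ⟨m, hm, h3⟩
    · intro hw
      obtain ⟨x, X, l, n, L, h1, h2⟩ := Expo.ofLexpo hw
      obtain ⟨cs, hcs, _⟩ := (Expo.complete h1 h2).comp
      exact ⟨cs, hcs⟩
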